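/- If k1 and k2 are both overlap lengths of u onto v with k1 < k2, then k1 is a self-overlap length of the prefix of v of length k2 (equivalently, the word v[1..k2] has a border of length k1). -/

import Mathlib

def OverlapsAt (u v : List Char) (k : ℕ) : Prop :=
  1 ≤ k ∧ k ≤ min u.length v.length ∧ u.drop (u.length - k) = v.take k

def SelfOverlapAt (u : List Char) (k : ℕ) : Prop :=
  1 ≤ k ∧ k ≤ u.length ∧ u.drop (u.length - k) = u.take k

theorem stmt_9 (u v : List Char) (k₁ k₂ : ℕ)
    (h1 : OverlapsAt u v k₁) (h2 : OverlapsAt u v k₂) (hlt : k₁ < k₂) :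
    SelfOverlapAt (v.take k₂) k₁ := by
  obtain ⟨a1, b1, c1⟩ := h1
  obtain ⟨a2, b2, c2⟩ := h2
  have hl : (v.take k₂).length = k₂ := by
    rw [List.length_take]; omega
  refine ⟨a1, by omega, ?_⟩
  rw [hl, List.take_take, min_eq_left hlt.le, ← c1, ← c2, List.drop_drop]
  congr 1
  omega
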